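/- Let K be a natural number. The binomial coefficients C(K−p, p) are even for all integers p with 0 < p ≤ K/2 if and only if K+1 is a power of 2. -/

import Mathlib

theorem Nat.even_choose_two_mul_of_odd (n q : ℕ) : Even ((2 * n).choose (2 * q + 1)) := by
  have h := Choose.choose_modEq_choose_mod_mul_choose_div_nat (n := 2 * n) (k := 2 * q + 1) (p := 2)
  rw [show 2 * n % 2 = 0 by lia, show (2 * q + 1) % 2 = 1 by lia] at h
  simpa [Nat.ModEq, Nat.even_iff] using h

theorem Nat.even_choose_two_mul_add_one_two_mul (n q : ℕ) :
    Even ((2 * n + 1).choose (2 * q)) ↔ Even (n.choose q) := by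
  have h := Choose.choose_modEq_choose_mod_mul_choose_div_nat (n := 2 * n + 1) (k := 2 * q) (p := 2)
  rw [show (2 * n + 1) % 2 = 1 by lia, show 2 * q % 2 = 0 by lia,
    show (2 * n + 1) / 2 = n by lia, show 2 * q / 2 = q by lia, Nat.choose_zero_right,
    one_mul] at h
  rw [Nat.even_iff, Nat.even_iff, h]

/-- The binomial coefficients `C(K - p, p)` are even for all `0 < p ≤ K / 2`
if and only if `K + 1` is a power of `2`. -/
theorem stmt1 (K : ℕ) :
    (∀ p : ℕ, 0 < p → 2 * p ≤ K → Even ((K - p).choose p)) ↔ ∃ a : ℕ, K + 1 = 2 ^ a := by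
  induction K using Nat.strong_induction_on with
  | _ K ih =>
    obtain ⟨m, rfl | rfl⟩ := K.even_or_odd'
    · rcases m.eq_zero_or_pos with rfl | hm
      · exact ⟨fun _ => ⟨0, rfl⟩, fun _ p _ _ => by lia⟩
      · refine ⟨fun h => ?_, fun ⟨a, ha⟩ => ?_⟩
        · have h1 := h m hm le_rfl
          rw [show 2 * m - m = m by lia, Nat.choose_self] at h1
          exact absurd h1 (by decide)
        · cases a with
          | zero => rw [pow_zero] at ha; lia
          | succ a => rw [pow_succ] at ha; lia
    · have hpow : (∃ a : ℕ, 2 * m + 1 + 1 = 2 ^ a) ↔ ∃ a : ℕ, m + 1 = 2 ^ a := by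
        refine ⟨fun ⟨a, ha⟩ => ?_, fun ⟨a, ha⟩ => ⟨a + 1, by rw [pow_succ]; lia⟩⟩
        cases a with
        | zero => rw [pow_zero] at ha; lia
        | succ a => exact ⟨a, by rw [pow_succ] at ha; lia⟩
      rw [hpow, ← ih m (by lia)]
      refine ⟨fun h q hq hqm => ?_, fun h p hp hpm => ?_⟩
      · rw [← Nat.even_choose_two_mul_add_one_two_mul,
          show 2 * (m - q) + 1 = 2 * m + 1 - 2 * q by lia]
        exact h (2 * q) (by lia) (by lia)
      · obtain ⟨q, rfl | rfl⟩ := p.even_or_odd'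
        · rw [show 2 * m + 1 - 2 * q = 2 * (m - q) + 1 by lia,
            Nat.even_choose_two_mul_add_one_two_mul]
          exact h q (by lia) (by lia)
        · rw [show 2 * m + 1 - (2 * q + 1) = 2 * (m - q) by lia]
          exact Nat.even_choose_two_mul_of_odd _ _
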